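/- arXiv:1901.02343 — 3 statements merged into one kernel-verified Lean document; each statement's English description precedes it below -/
import Mathlib

section
/- For every non-negative integer n, every integer k and every real number x, writing S_{G,n}(x) = ∑_{j=0}^{n} x^j G_j², one has x·∑_{j=0}^{n} x^j G_{j+k}² = (x·F_{k+1}·F_{k−1} + F_{k+1}·F_k − x²·F_{k−1}·F_k)·S_{G,n}(x) + x·F_{k−1}·F_k·(x^{n+1}·G_n² − G_0² − G_1² + 2·G_0·G_1) + F_{k+1}·F_k·(x^{n+1}·G_{n+1}² − G_0²). -/
/-- The addition formula expressing a Fibonacci-like sequence through Fibonacci numbers. -/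
theorem fibonacciLike_add (F G : ℤ → ℤ)
    (hF0 : F 0 = 0) (hF1 : F 1 = 1)
    (hF : ∀ j : ℤ, F j = F (j - 1) + F (j - 2))
    (hG : ∀ j : ℤ, G j = G (j - 1) + G (j - 2)) (m k : ℤ) :
    G (m + k) = F k * G (m + 1) + F (k - 1) * G m := by
  have hF' (j : ℤ) : F (j + 1) = F j + F (j - 1) := by
    have h := hF (j + 1)
    rwa [show j + 1 - 1 = j by ring, show j + 1 - 2 = j - 1 by ring] at h
  have hG' (j : ℤ) : G (j + 1) = G j + G (j - 1) := by
    have h := hG (j + 1)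
    rwa [show j + 1 - 1 = j by ring, show j + 1 - 2 = j - 1 by ring] at h
  have hFneg : F (-1) = 1 := by
    have h := hF' 0
    norm_num at h
    linarith
  have key : G (m + k) = F k * G (m + 1) + F (k - 1) * G m ∧
      G (m + k + 1) = F (k + 1) * G (m + 1) + F k * G m := by
    induction k using Int.induction_on with
    | zero => simp [hF0, hF1, hFneg]
    | succ i ih =>
      obtain ⟨h₁, h₂⟩ := ih
      have hg := hG' (m + i + 1)
      have hf := hF' (i + 1 : ℤ)
      have hf' := hF' (i : ℤ)
      rw [add_sub_cancel_right] at hg hf ⊢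
      rw [← add_assoc]
      refine ⟨h₂, ?_⟩
      rw [hg, hf, h₁, h₂, hf']
      ring
    | pred i ih =>
      obtain ⟨h₁, h₂⟩ := ih
      have hg := hG' (m + -(i : ℤ))
      have hf := hF' (-(i : ℤ))
      have hf' := hF' (-(i : ℤ) - 1)
      rw [sub_add_cancel] at hf' ⊢
      rw [← add_sub_assoc, sub_add_cancel]
      refine ⟨?_, h₁⟩
      linear_combination h₂ - h₁ - hg + G (m + 1) * hf + G m * hf'
  exact key.1


/-- For every non-negative integer `n`, integer `k` and real `x`, with
`S_{G,n}(x) = ∑_{j=0}^n x^j G_j²`: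
`x ∑_{j=0}^n x^j G_{j+k}² = (x F_{k+1} F_{k-1} + F_{k+1} F_k - x² F_{k-1} F_k) S_{G,n}(x)
  + x F_{k-1} F_k (x^{n+1} G_n² - G_0² - G_1² + 2 G_0 G_1)
  + F_{k+1} F_k (x^{n+1} G_{n+1}² - G_0²)`. -/
theorem stmt_3 (F G : ℤ → ℤ)
    (hF0 : F 0 = 0) (hF1 : F 1 = 1)
    (hF : ∀ j : ℤ, F j = F (j - 1) + F (j - 2))
    (hG : ∀ j : ℤ, G j = G (j - 1) + G (j - 2))
    (n : ℕ) (k : ℤ) (x : ℝ) :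
    x * ∑ j ∈ Finset.range (n + 1), x ^ j * (G ((j : ℤ) + k) : ℝ) ^ 2 =
      (x * (F (k + 1) : ℝ) * (F (k - 1) : ℝ) + (F (k + 1) : ℝ) * (F k : ℝ)
          - x ^ 2 * (F (k - 1) : ℝ) * (F k : ℝ))
        * ∑ j ∈ Finset.range (n + 1), x ^ j * (G j : ℝ) ^ 2
      + x * (F (k - 1) : ℝ) * (F k : ℝ)
        * (x ^ (n + 1) * (G (n : ℤ) : ℝ) ^ 2 - (G 0 : ℝ) ^ 2 - (G 1 : ℝ) ^ 2
            + 2 * (G 0 : ℝ) * (G 1 : ℝ))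
      + (F (k + 1) : ℝ) * (F k : ℝ)
        * (x ^ (n + 1) * (G ((n : ℤ) + 1) : ℝ) ^ 2 - (G 0 : ℝ) ^ 2) := by
  have hG' (j : ℤ) : (G (j + 2) : ℝ) = G (j + 1) + G j := by
    have h := hG (j + 2)
    rw [show j + 2 - 1 = j + 1 by ring, show j + 2 - 2 = j by ring] at h
    exact_mod_cast h
  have hFk : (F (k + 1) : ℝ) = F k + F (k - 1) := by
    have h := hF (k + 1)
    rw [show k + 1 - 1 = k by ring, show k + 1 - 2 = k - 1 by ring] at h
    exact_mod_cast h
  have hadd (m : ℤ) : (G (m + k) : ℝ) = F k * G (m + 1) + F (k - 1) * G m := by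
    exact_mod_cast fibonacciLike_add F G hF0 hF1 hF hG m k
  induction n with
  | zero =>
    simp only [zero_add, Finset.sum_range_one, Nat.cast_zero, hFk]
    rw [← zero_add k, hadd 0, zero_add, zero_add]
    ring
  | succ n ih =>
    rw [Finset.sum_range_succ, mul_add, ih, Finset.sum_range_succ _ (n + 1), hadd]
    push_cast
    rw [show (n : ℤ) + 1 + 1 = n + 2 by ring, hG', hFk]
    ring
end

section
/- For every non-negative integer n and every integer k, ∑_{j=0}^{n} G_{j+k}² = F_n·F_{n+1}·(G_{k+1}² + G_k²) + (F_n² − 1)·(G_{k+1}² − G_{k−1}²) + (1 + (−1)^n)·G_{k+1}·G_k. -/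
theorem fib_cassini (F : ℤ → ℤ) (hF0 : F 0 = 0) (hF1 : F 1 = 1)
    (hF : ∀ j : ℤ, F j = F (j - 1) + F (j - 2)) (n : ℕ) :
    F ((n : ℤ) + 1) ^ 2 - F n * F ((n : ℤ) + 1) - F n ^ 2 = (-1) ^ n := by
  induction n with
  | zero => simp [hF0, hF1]
  | succ n ih =>
    have h := hF ((n : ℤ) + 1 + 1)
    rw [show (n : ℤ) + 1 + 1 - 1 = n + 1 by ring, show (n : ℤ) + 1 + 1 - 2 = n by ring] at h
    push_cast
    rw [h, pow_succ (-1 : ℤ), ← ih]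
    ring

theorem fibonacciLike_eq (F G : ℤ → ℤ) (hF0 : F 0 = 0) (hF1 : F 1 = 1)
    (hF : ∀ j : ℤ, F j = F (j - 1) + F (j - 2))
    (hG : ∀ j : ℤ, G j = G (j - 1) + G (j - 2)) (n : ℕ) (k : ℤ) :
    G ((n : ℤ) + 1 + k) = F ((n : ℤ) + 1) * G (k + 1) + F n * G k := by
  induction n generalizing k with
  | zero => simp [hF0, hF1, add_comm]
  | succ n ih =>
    have h := hF ((n : ℤ) + 1 + 1)
    rw [show (n : ℤ) + 1 + 1 - 1 = n + 1 by ring, show (n : ℤ) + 1 + 1 - 2 = n by ring] at h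
    have g := hG (k + 1 + 1)
    rw [show k + 1 + 1 - 1 = k + 1 by ring, show k + 1 + 1 - 2 = k by ring] at g
    push_cast
    rw [show (n : ℤ) + 1 + 1 + k = n + 1 + (k + 1) by ring, ih (k + 1), g, h]
    ring


/-- For every non-negative integer `n` and integer `k`,
`∑_{j=0}^n G_{j+k}² = F_n F_{n+1} (G_{k+1}² + G_k²) + (F_n² - 1)(G_{k+1}² - G_{k-1}²)
  + (1 + (-1)^n) G_{k+1} G_k`. -/
theorem stmt_10 (F G : ℤ → ℤ)
    (hF0 : F 0 = 0) (hF1 : F 1 = 1)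
    (hF : ∀ j : ℤ, F j = F (j - 1) + F (j - 2))
    (hG : ∀ j : ℤ, G j = G (j - 1) + G (j - 2))
    (n : ℕ) (k : ℤ) :
    ∑ j ∈ Finset.range (n + 1), G ((j : ℤ) + k) ^ 2 =
      F n * F ((n : ℤ) + 1) * (G (k + 1) ^ 2 + G k ^ 2)
      + (F n ^ 2 - 1) * (G (k + 1) ^ 2 - G (k - 1) ^ 2)
      + (1 + (-1 : ℤ) ^ n) * G (k + 1) * G k := by
  have hg := hG (k + 1)
  rw [show k + 1 - 1 = k by ring, show k + 1 - 2 = k - 1 by ring] at hg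
  have hk : G (k - 1) = G (k + 1) - G k := by rw [hg]; ring
  rw [hk]
  induction n with
  | zero =>
    simp [hF0]
    ring
  | succ n ih =>
    have h := hF ((n : ℤ) + 1 + 1)
    rw [show (n : ℤ) + 1 + 1 - 1 = n + 1 by ring, show (n : ℤ) + 1 + 1 - 2 = n by ring] at h
    rw [Finset.sum_range_succ, ih]
    push_cast
    rw [fibonacciLike_eq F G hF0 hF1 hF hG n k, h, pow_succ (-1 : ℤ),
      ← fib_cassini F hF0 hF1 hF n]
    ring
end

section
/- For every non-negative integer n, all integers s and k, and every real number x, writing A_n(x;k) = ∑_{j=0}^{n} x^j G_{j+k}², one has 2·F_s·F_k·∑_{j=0}^{n} x^j G_{j+k}·G_{j+s} = F_s²·A_n(x;k) + F_k²·A_n(x;s) − F_{s−k}²·A_n(x;0). -/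
/-- An integer sequence satisfying the Fibonacci recurrence is determined by two adjacent values. -/
theorem fibLike_eq_zero {H : ℤ → ℤ} (hH : ∀ j : ℤ, H j = H (j - 1) + H (j - 2))
    (h0 : H 0 = 0) (h1 : H 1 = 0) (k : ℤ) : H k = 0 := by
  suffices h : H k = 0 ∧ H (k + 1) = 0 from h.1
  induction k using Int.induction_on with
  | zero => exact ⟨h0, h1⟩
  | succ i ih =>
    have h := hH ((i : ℤ) + 1 + 1)
    rw [show (i : ℤ) + 1 + 1 - 1 = i + 1 by ring, show (i : ℤ) + 1 + 1 - 2 = i by ring] at h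
    exact ⟨ih.2, by rw [h, ih.1, ih.2, add_zero]⟩
  | pred i ih =>
    have h := hH (-(i : ℤ) + 1)
    rw [show -(i : ℤ) + 1 - 1 = -i by ring, show -(i : ℤ) + 1 - 2 = -i - 1 by ring] at h
    rw [show -(i : ℤ) - 1 + 1 = -i by ring]
    exact ⟨by linarith [ih.1, ih.2], ih.1⟩

/-- The addition formula expressing a Fibonacci-like sequence through the Fibonacci numbers. -/
theorem fibLike_add {F G : ℤ → ℤ} (hF0 : F 0 = 0) (hF1 : F 1 = 1)
    (hF : ∀ j : ℤ, F j = F (j - 1) + F (j - 2))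
    (hG : ∀ j : ℤ, G j = G (j - 1) + G (j - 2)) (j k : ℤ) :
    G (j + k) = F k * G (j + 1) + F (k - 1) * G j := by
  have hFneg : F (-1) = 1 := by
    have h := hF 1
    norm_num at h
    linarith
  have h := fibLike_eq_zero (H := fun k => G (j + k) - (F k * G (j + 1) + F (k - 1) * G j))
    (fun i => by
      have h1 := hG (j + i)
      have h2 := hF i
      have h3 := hF (i - 1)
      rw [show i - 1 - 2 = i - 2 - 1 by ring] at h3
      simp only [← add_sub_assoc]
      rw [h1, h2, h3]
      ring)
    (by simp [hF0, hFneg]) (by simp [hF0, hF1]) k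
  exact sub_eq_zero.mp h

/-- A squared form of Cassini's identity, valid at all integer indices. -/
theorem fib_cassini_sq {F : ℤ → ℤ} (hF0 : F 0 = 0) (hF1 : F 1 = 1)
    (hF : ∀ j : ℤ, F j = F (j - 1) + F (j - 2)) (k : ℤ) :
    (F k * F (k - 1) + F (k - 1) ^ 2 - F k ^ 2) ^ 2 = 1 := by
  induction k using Int.induction_on with
  | zero =>
    have h := hF 1
    norm_num at h
    have hFneg : F (-1) = 1 := by linarith
    simp [hF0, hFneg]
  | succ i ih =>
    have h := hF ((i : ℤ) + 1)
    rw [show (i : ℤ) + 1 - 1 = i by ring, show (i : ℤ) + 1 - 2 = i - 1 by ring] at h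
    rw [show (i : ℤ) + 1 - 1 = i by ring, h]
    linear_combination ih
  | pred i ih =>
    have h := hF (-(i : ℤ))
    rw [show -(i : ℤ) - 2 = -i - 1 - 1 by ring] at h
    rw [h] at ih
    linear_combination ih

/-- A squared form of d'Ocagne's identity for Fibonacci-like sequences. -/
theorem fibLike_docagne_sq {F G : ℤ → ℤ} (hF0 : F 0 = 0) (hF1 : F 1 = 1)
    (hF : ∀ j : ℤ, F j = F (j - 1) + F (j - 2))
    (hG : ∀ j : ℤ, G j = G (j - 1) + G (j - 2)) (j s k : ℤ) :
    (F s * G (j + k) - F k * G (j + s)) ^ 2 = F (s - k) ^ 2 * G j ^ 2 := by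
  have h1 := fibLike_add hF0 hF1 hF hF (s - k) k
  have h2 := fibLike_add hF0 hF1 hF hF (s - k - 1) k
  have h3 := hF (s - k + 1)
  rw [show s - k + 1 - 1 = s - k by ring, show s - k + 1 - 2 = s - k - 1 by ring] at h3
  rw [sub_add_cancel, h3] at h1
  rw [show s - k - 1 + k = s - 1 by ring, sub_add_cancel] at h2
  have h4 : F s * F (k - 1) - F k * F (s - 1)
      = F (s - k) * (F k * F (k - 1) + F (k - 1) ^ 2 - F k ^ 2) := by
    rw [h1, h2]
    ring
  calc (F s * G (j + k) - F k * G (j + s)) ^ 2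
      = ((F s * F (k - 1) - F k * F (s - 1)) * G j) ^ 2 := by
        rw [fibLike_add hF0 hF1 hF hG j k, fibLike_add hF0 hF1 hF hG j s]
        ring
    _ = F (s - k) ^ 2 * G j ^ 2 := by
        rw [h4, mul_pow, mul_pow, fib_cassini_sq hF0 hF1 hF k, mul_one]

/-- For every non-negative integer `n`, integers `s`, `k` and real `x`, with
`A_n(x;k) = ∑_{j=0}^n x^j G_{j+k}²`:
`2 F_s F_k ∑_{j=0}^n x^j G_{j+k} G_{j+s} = F_s² A_n(x;k) + F_k² A_n(x;s) - F_{s-k}² A_n(x;0)`. -/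
theorem stmt_12 (F G : ℤ → ℤ)
    (hF0 : F 0 = 0) (hF1 : F 1 = 1)
    (hF : ∀ j : ℤ, F j = F (j - 1) + F (j - 2))
    (hG : ∀ j : ℤ, G j = G (j - 1) + G (j - 2))
    (n : ℕ) (s k : ℤ) (x : ℝ) :
    2 * (F s : ℝ) * (F k : ℝ)
        * ∑ j ∈ Finset.range (n + 1), x ^ j * (G ((j : ℤ) + k) : ℝ) * (G ((j : ℤ) + s) : ℝ) =
      (F s : ℝ) ^ 2 * ∑ j ∈ Finset.range (n + 1), x ^ j * (G ((j : ℤ) + k) : ℝ) ^ 2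
      + (F k : ℝ) ^ 2 * ∑ j ∈ Finset.range (n + 1), x ^ j * (G ((j : ℤ) + s) : ℝ) ^ 2
      - (F (s - k) : ℝ) ^ 2 * ∑ j ∈ Finset.range (n + 1), x ^ j * (G j : ℝ) ^ 2 := by
  simp only [Finset.mul_sum]
  rw [← Finset.sum_add_distrib, ← Finset.sum_sub_distrib]
  refine Finset.sum_congr rfl fun j _ => ?_
  have h : ((F s : ℝ) * G (j + k) - F k * G (j + s)) ^ 2 = (F (s - k) : ℝ) ^ 2 * (G j : ℝ) ^ 2 := by
    exact_mod_cast fibLike_docagne_sq hF0 hF1 hF hG j s k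
  linear_combination -x ^ j * h
end
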